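/- arXiv:2010.02040 — 2 statements merged into one kernel-verified Lean document; each statement's English description precedes it below -/
import Mathlib

section
/- Let α, T, φ₁, φ₂ be positive real numbers and let δ : [0,T] → ℝ be a continuous function satisfying |δ(t)| ≤ φ₁ + (φ₂/Γ(α)) ∫_0^t (t−τ)^{α−1} |δ(τ)| dτ for all t ∈ [0,T]. Then |δ(t)| ≤ φ₁ · E_α(φ₂ t^α) for all t ∈ [0,T]. -/
/-- The Mittag-Leffler function `E_α(x) = ∑_{n=0}^∞ x^n / Γ(nα + 1)`. -/
noncomputable def mittagLeffler (α x : ℝ) : ℝ :=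
  ∑' n : ℕ, x ^ n / Real.Gamma (n * α + 1)

open MeasureTheory Filter Topology

/-- The fractional-integral kernel `(t - τ) ^ (α - 1)` is integrable on `[0, t]`. -/
lemma intervalIntegrable_sub_rpow {α : ℝ} (hα : 0 < α) (t : ℝ) :
    IntervalIntegrable (fun τ : ℝ => (t - τ) ^ (α - 1)) volume 0 t := by
  have h := (intervalIntegral.intervalIntegrable_rpow' (a := 0) (b := t)
    (by linarith : -1 < α - 1)).comp_sub_left t
  simpa using h.symm

/-- The Beta integral over `[0, t]`, evaluated by the real Gamma function. -/
lemma integral_sub_rpow_mul_rpow {α b t : ℝ} (hα : 0 < α) (hb : 0 ≤ b) (ht : 0 ≤ t) :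
    ∫ τ in (0:ℝ)..t, (t - τ) ^ (α - 1) * τ ^ b =
      Real.Gamma α * Real.Gamma (b + 1) / Real.Gamma (b + α + 1) * t ^ (b + α) := by
  rcases ht.eq_or_lt with rfl | ht
  · simp [Real.zero_rpow (by linarith : b + α ≠ 0)]
  have hbeta := ProbabilityTheory.beta_eq_betaIntegralReal (b + 1) α (by linarith) hα
  have hs := Complex.betaIntegral_scaled ((b + 1 : ℝ) : ℂ) (α : ℂ) ht
  have hI : (∫ x in (0:ℝ)..t, (x : ℂ) ^ (((b + 1 : ℝ) : ℂ) - 1) * ((t : ℂ) - x) ^ ((α : ℂ) - 1)) =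
      ((∫ τ in (0:ℝ)..t, (t - τ) ^ (α - 1) * τ ^ b : ℝ) : ℂ) := by
    rw [← intervalIntegral.integral_ofReal]
    refine intervalIntegral.integral_congr fun x hx => ?_
    rw [Set.uIcc_of_le ht.le] at hx
    simp only [Complex.ofReal_mul, Complex.ofReal_cpow hx.1,
      Complex.ofReal_cpow (sub_nonneg.2 hx.2)]
    push_cast
    rw [add_sub_cancel_right, mul_comm]
  have hp : (t : ℂ) ^ (((b + 1 : ℝ) : ℂ) + α - 1) = ((t ^ (b + α) : ℝ) : ℂ) := by
    rw [Complex.ofReal_cpow ht.le]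
    congr 1
    push_cast
    ring
  rw [hI, hp] at hs
  have hre := congrArg Complex.re hs
  rw [Complex.ofReal_re, Complex.re_ofReal_mul, ← hbeta, ProbabilityTheory.beta] at hre
  rw [hre, show b + 1 + α = b + α + 1 by ring]
  ring

/-- Ratios of consecutive values of `n ↦ Γ(nα + 1)` tend to zero. -/
lemma tendsto_Gamma_div_Gamma_add {α : ℝ} (hα : 0 < α) :
    Tendsto (fun n : ℕ => Real.Gamma (n * α + 1) / Real.Gamma ((n + 1 : ℕ) * α + 1))
      atTop (𝓝 0) := by
  have h : Tendsto (fun n : ℕ => ∫ τ in (0:ℝ)..1, (1 - τ) ^ (α - 1) * τ ^ ((n : ℝ) * α))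
      atTop (𝓝 (∫ _ in (0:ℝ)..1, (0 : ℝ))) := by
    refine intervalIntegral.tendsto_integral_filter_of_dominated_convergence
      (fun τ : ℝ => (1 - τ) ^ (α - 1)) (Eventually.of_forall fun n => ?_)
      (Eventually.of_forall fun n => ae_of_all _ fun x hx => ?_)
      (intervalIntegrable_sub_rpow hα 1) ?_
    · exact Measurable.aestronglyMeasurable (by fun_prop)
    · rw [Set.uIoc_of_le zero_le_one] at hx
      have h1 : (0 : ℝ) ≤ (1 - x) ^ (α - 1) := Real.rpow_nonneg (by linarith [hx.2]) _
      rw [Real.norm_of_nonneg (mul_nonneg h1 (Real.rpow_nonneg hx.1.le _))]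
      exact mul_le_of_le_one_right h1 (Real.rpow_le_one hx.1.le hx.2 (by positivity))
    · filter_upwards [compl_mem_ae_iff.2 (measure_singleton (1 : ℝ))] with x hx1 hx
      rw [Set.uIoc_of_le zero_le_one] at hx
      have hlt : x ^ α < 1 := Real.rpow_lt_one hx.1.le (lt_of_le_of_ne hx.2 hx1) hα
      have := (tendsto_pow_atTop_nhds_zero_of_lt_one (Real.rpow_nonneg hx.1.le α) hlt).const_mul
        ((1 - x) ^ (α - 1))
      rw [mul_zero] at this
      refine this.congr fun n => ?_
      rw [mul_comm (n : ℝ), Real.rpow_mul_natCast hx.1.le]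
  rw [intervalIntegral.integral_zero] at h
  have h2 := h.const_mul (Real.Gamma α)⁻¹
  rw [mul_zero] at h2
  refine h2.congr fun n => ?_
  have hne := (Real.Gamma_pos_of_pos hα).ne'
  rw [integral_sub_rpow_mul_rpow hα (by positivity) zero_le_one, Real.one_rpow,
    show ((n + 1 : ℕ) : ℝ) * α + 1 = n * α + α + 1 by push_cast; ring]
  field_simp

/-- The Mittag-Leffler series converges on the nonnegative reals. -/
lemma summable_mittagLeffler {α x : ℝ} (hα : 0 < α) (hx : 0 ≤ x) :
    Summable (fun n : ℕ => x ^ n / Real.Gamma (n * α + 1)) := by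
  rcases hx.eq_or_lt with rfl | hx
  · refine summable_of_ne_finset_zero (s := {0}) fun n hn => ?_
    simp [zero_pow (by simpa using hn : n ≠ 0)]
  have hG (n : ℕ) : 0 < Real.Gamma (n * α + 1) := Real.Gamma_pos_of_pos (by positivity)
  refine summable_of_ratio_test_tendsto_lt_one zero_lt_one
    (Eventually.of_forall fun n => (div_pos (pow_pos hx n) (hG n)).ne') ?_
  have h := (tendsto_Gamma_div_Gamma_add hα).const_mul x
  rw [mul_zero] at h
  refine h.congr fun n => ?_
  have h1 := (hG n).ne'
  have h2 := (hG (n + 1)).ne'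
  rw [Real.norm_of_nonneg (div_pos (pow_pos hx _) (hG _)).le,
    Real.norm_of_nonneg (div_pos (pow_pos hx _) (hG _)).le, pow_succ]
  field_simp

/-- Fractional integration of order `α` shifts the terms of the series `E_α(φ t ^ α)`. -/
lemma fractional_integral_mittagLeffler_term {α φ t : ℝ} (hα : 0 < α) (ht : 0 ≤ t) (k : ℕ) :
    φ / Real.Gamma α * ∫ τ in (0:ℝ)..t,
        (t - τ) ^ (α - 1) * ((φ * τ ^ α) ^ k / Real.Gamma (k * α + 1)) =
      (φ * t ^ α) ^ (k + 1) / Real.Gamma ((k + 1 : ℕ) * α + 1) := by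
  have hI : ∫ τ in (0:ℝ)..t, (t - τ) ^ (α - 1) * ((φ * τ ^ α) ^ k / Real.Gamma (k * α + 1)) =
      φ ^ k / Real.Gamma (k * α + 1) * ∫ τ in (0:ℝ)..t, (t - τ) ^ (α - 1) * τ ^ (k * α) := by
    rw [← intervalIntegral.integral_const_mul]
    refine intervalIntegral.integral_congr fun x hx => ?_
    rw [Set.uIcc_of_le ht] at hx
    simp only [mul_comm (k : ℝ) α, Real.rpow_mul_natCast hx.1]
    ring
  have h1 := (Real.Gamma_pos_of_pos hα).ne'
  have h2 : Real.Gamma (k * α + 1) ≠ 0 := (Real.Gamma_pos_of_pos (by positivity)).ne'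
  have h3 : Real.Gamma (k * α + α + 1) ≠ 0 := (Real.Gamma_pos_of_pos (by positivity)).ne'
  rw [hI, integral_sub_rpow_mul_rpow hα (by positivity) ht,
    show ((k + 1 : ℕ) : ℝ) * α + 1 = k * α + α + 1 by push_cast; ring,
    show (k : ℝ) * α + α = α * (k + 1 : ℕ) by push_cast; ring, Real.rpow_mul_natCast ht, mul_pow]
  field_simp
  ring

/-- Iterating the fractional Grönwall inequality `n` times, starting from `|δ| ≤ M`. -/
lemma abs_le_partial_sum_mittagLeffler {α T φ₁ φ₂ M : ℝ} {δ : ℝ → ℝ}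
    (hα : 0 < α) (hφ₂ : 0 ≤ φ₂) (hδ : ContinuousOn δ (Set.Icc 0 T))
    (hineq : ∀ t ∈ Set.Icc (0:ℝ) T,
      |δ t| ≤ φ₁ + φ₂ / Real.Gamma α * ∫ τ in (0:ℝ)..t, (t - τ) ^ (α - 1) * |δ τ|)
    (hM : ∀ t ∈ Set.Icc (0:ℝ) T, |δ t| ≤ M) (n : ℕ) :
    ∀ t ∈ Set.Icc (0:ℝ) T, |δ t| ≤
      φ₁ * ∑ k ∈ Finset.range n, (φ₂ * t ^ α) ^ k / Real.Gamma (k * α + 1) +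
        M * ((φ₂ * t ^ α) ^ n / Real.Gamma (n * α + 1)) := by
  induction n with
  | zero => intro t ht; simpa using hM t ht
  | succ n ih =>
    intro t ht
    have hterm (k : ℕ) : IntervalIntegrable (fun τ : ℝ =>
        (t - τ) ^ (α - 1) * ((φ₂ * τ ^ α) ^ k / Real.Gamma (k * α + 1))) volume 0 t := by
      refine (intervalIntegrable_sub_rpow hα t).mul_continuousOn (Continuous.continuousOn ?_)
      exact (((Real.continuous_rpow_const hα.le).const_mul φ₂).pow k).div_const _
    have hδt : IntervalIntegrable (fun τ : ℝ => (t - τ) ^ (α - 1) * |δ τ|) volume 0 t := by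
      refine (intervalIntegrable_sub_rpow hα t).mul_continuousOn ?_
      rw [Set.uIcc_of_le ht.1]
      exact (hδ.mono (Set.Icc_subset_Icc_right ht.2)).abs
    have hsum : IntervalIntegrable (fun τ : ℝ => ∑ k ∈ Finset.range n,
        (t - τ) ^ (α - 1) * ((φ₂ * τ ^ α) ^ k / Real.Gamma (k * α + 1))) volume 0 t := by
      simpa only [Finset.sum_fn] using
        IntervalIntegrable.sum (Finset.range n) fun k _ => hterm k
    have hmono : ∫ τ in (0:ℝ)..t, (t - τ) ^ (α - 1) * |δ τ| ≤
        ∫ τ in (0:ℝ)..t, (φ₁ * ∑ k ∈ Finset.range n,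
          (t - τ) ^ (α - 1) * ((φ₂ * τ ^ α) ^ k / Real.Gamma (k * α + 1)) +
          M * ((t - τ) ^ (α - 1) * ((φ₂ * τ ^ α) ^ n / Real.Gamma (n * α + 1)))) := by
      refine intervalIntegral.integral_mono_on ht.1 hδt
        ((hsum.const_mul φ₁).add ((hterm n).const_mul M)) fun τ hτ => ?_
      refine (mul_le_mul_of_nonneg_left (ih τ ⟨hτ.1, hτ.2.trans ht.2⟩)
        (Real.rpow_nonneg (sub_nonneg.2 hτ.2) _)).trans_eq ?_
      rw [← Finset.mul_sum]
      ring
    rw [intervalIntegral.integral_add (hsum.const_mul φ₁) ((hterm n).const_mul M),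
      intervalIntegral.integral_const_mul, intervalIntegral.integral_const_mul,
      intervalIntegral.integral_finsetSum fun k _ => hterm k] at hmono
    have hc : 0 ≤ φ₂ / Real.Gamma α := div_nonneg hφ₂ (Real.Gamma_pos_of_pos hα).le
    refine (hineq t ht).trans ((add_le_add_right (mul_le_mul_of_nonneg_left hmono hc) φ₁).trans_eq ?_)
    rw [Finset.sum_range_succ', ← fractional_integral_mittagLeffler_term hα ht.1 n]
    simp_rw [← fractional_integral_mittagLeffler_term hα ht.1]
    rw [← Finset.mul_sum]
    simp
    ring

theorem stmt3 (α T φ₁ φ₂ : ℝ) (δ : ℝ → ℝ)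
    (hα : 0 < α) (hT : 0 < T) (hφ₁ : 0 < φ₁) (hφ₂ : 0 < φ₂)
    (hδ : ContinuousOn δ (Set.Icc 0 T))
    (hineq : ∀ t ∈ Set.Icc (0:ℝ) T,
      |δ t| ≤ φ₁ + φ₂ / Real.Gamma α * ∫ τ in (0:ℝ)..t, (t - τ) ^ (α - 1) * |δ τ|) :
    ∀ t ∈ Set.Icc (0:ℝ) T, |δ t| ≤ φ₁ * mittagLeffler α (φ₂ * t ^ α) := by
  obtain ⟨M, hM⟩ := isCompact_Icc.exists_bound_of_continuousOn hδ
  intro t ht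
  have hs := summable_mittagLeffler hα (mul_nonneg hφ₂.le (Real.rpow_nonneg ht.1 α))
  have hlim := (hs.hasSum.tendsto_sum_nat.const_mul φ₁).add (hs.tendsto_atTop_zero.const_mul M)
  rw [mul_zero, add_zero] at hlim
  exact ge_of_tendsto' hlim fun n =>
    abs_le_partial_sum_mittagLeffler hα hφ₂.le hδ hineq hM n t ht
end

section
/- Under the Volterra system setup, for every t ∈ [0,T], |z(t) − z̃(t)| ≤ L C¹_ε · J^{α₂−1}_0 |z − z̃|(t) + L C²_ε · ‖J^ε_0 z̃ − z̃‖_∞, where C¹_ε := (Γ(α₂−1)/Γ(α₂−1+ε)) T^ε + (Γ(α₂−1)/Γ(α₂)) T and C²_ε := T^{α₂−ε}/Γ(α₂−ε+1) + T^{α₂−1}/Γ(α₂). -/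
/-- Riemann–Liouville fractional integral of order `α` with base point `a`. -/
noncomputable def rlInt (a α : ℝ) (y : ℝ → ℝ) (t : ℝ) : ℝ :=
  (1 / Real.Gamma α) * ∫ τ in a..t, (t - τ) ^ (α - 1) * y τ

section

open MeasureTheory Set
open scoped ENNReal

/-- The Riemann–Liouville kernel `x ↦ x ^ (a - 1) / Γ(a)` on `(0, ∞)`, extended by zero. -/
noncomputable def rlKernel (a : ℝ) : ℝ → ℝ≥0∞ :=
  (Ioi 0).indicator fun x => ENNReal.ofReal (x ^ (a - 1) / Real.Gamma a)

/-- The absolute value of `g`, restricted to `(0, T]`. -/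
noncomputable def absTrunc (T : ℝ) (g : ℝ → ℝ) : ℝ → ℝ≥0∞ :=
  (Ioc 0 T).indicator fun x => ENNReal.ofReal |g x|

lemma measurable_rlKernel (a : ℝ) : Measurable (rlKernel a) :=
  Measurable.indicator (by fun_prop) measurableSet_Ioi

lemma measurable_absTrunc {T : ℝ} {g : ℝ → ℝ} (hg : ContinuousOn g (Icc 0 T)) :
    Measurable (absTrunc T g) := by
  unfold absTrunc
  classical
  rw [← piecewise_eq_indicator]
  exact ContinuousOn.measurable_piecewise
    (ENNReal.continuous_ofReal.comp_continuousOn (hg.mono Ioc_subset_Icc_self).abs)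
    continuousOn_const measurableSet_Ioc

lemma rlKernel_of_pos {x : ℝ} (a : ℝ) (hx : 0 < x) :
    rlKernel a x = ENNReal.ofReal (x ^ (a - 1) / Real.Gamma a) :=
  indicator_of_mem hx _

lemma rlKernel_of_nonpos {x : ℝ} (a : ℝ) (hx : x ≤ 0) : rlKernel a x = 0 :=
  indicator_of_notMem (by simpa using hx) _

lemma rlKernel_lconvolution_rlKernel {a b : ℝ} (ha : 0 < a) (hb : 0 < b) :
    rlKernel a ⋆ₗ rlKernel b = rlKernel (a + b) := by
  ext x
  rw [lconvolution_def]
  rcases le_or_gt x 0 with hx | hx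
  · rw [rlKernel_of_nonpos _ hx]
    refine (lintegral_congr fun y => ?_).trans lintegral_zero
    rcases le_or_gt y 0 with hy | hy
    · rw [rlKernel_of_nonpos _ hy, zero_mul]
    · rw [rlKernel_of_nonpos b (by linarith), mul_zero]
  have hΓa := Real.Gamma_pos_of_pos ha
  have hΓb := Real.Gamma_pos_of_pos hb
  have hΓ := Real.Gamma_pos_of_pos (add_pos ha hb)
  have key : ∀ u : ℝ, rlKernel a (x * u) * rlKernel b (-(x * u) + x) =
      ENNReal.ofReal (x ^ (a + b - 2) / Real.Gamma (a + b)) * ProbabilityTheory.betaPDF a b u := by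
    intro u
    rcases le_or_gt u 0 with hu | hu
    · rw [ProbabilityTheory.betaPDF_eq_zero_of_nonpos hu, mul_zero,
        rlKernel_of_nonpos a (mul_nonpos_of_nonneg_of_nonpos hx.le hu), zero_mul]
    rcases le_or_gt 1 u with hu1 | hu1
    · rw [ProbabilityTheory.betaPDF_eq_zero_of_one_le hu1, mul_zero,
        rlKernel_of_nonpos b (by nlinarith), mul_zero]
    have h1u : 0 < 1 - u := by linarith
    rw [ProbabilityTheory.betaPDF_of_pos_lt_one hu hu1, rlKernel_of_pos a (by positivity),
      rlKernel_of_pos b (by nlinarith), ← ENNReal.ofReal_mul (by positivity),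
      ← ENNReal.ofReal_mul (by positivity), show -(x * u) + x = x * (1 - u) by ring,
      Real.mul_rpow hx.le hu.le, Real.mul_rpow hx.le h1u.le,
      show a + b - 2 = (a - 1) + (b - 1) by ring, Real.rpow_add hx, ProbabilityTheory.beta]
    congr 1
    field_simp
  have hscale : ∫⁻ y, rlKernel a y * rlKernel b (-y + x) =
      ENNReal.ofReal x * ∫⁻ u, rlKernel a (x * u) * rlKernel b (-(x * u) + x) := by
    have hm : Measurable fun y => rlKernel a y * rlKernel b (-y + x) :=
      (measurable_rlKernel a).mul ((measurable_rlKernel b).comp (by fun_prop))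
    conv_lhs => rw [← Real.smul_map_volume_mul_left hx.ne']
    rw [lintegral_smul_measure, lintegral_map hm (by fun_prop), abs_of_pos hx, smul_eq_mul]
  rw [hscale, lintegral_congr key, lintegral_const_mul' _ _ ENNReal.ofReal_ne_top,
    ProbabilityTheory.lintegral_betaPDF_eq_one ha hb, mul_one, rlKernel_of_pos _ hx,
    ← ENNReal.ofReal_mul hx.le]
  congr 1
  rw [show a + b - 1 = (a + b - 2) + 1 by ring, Real.rpow_add_one hx.ne']
  ring

lemma lconvolution_mono {g g' k : ℝ → ℝ≥0∞} (h : g ≤ g') : g ⋆ₗ k ≤ g' ⋆ₗ k :=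
  fun _ => lintegral_mono fun y => mul_le_mul_left (h y) _

lemma rlInt_eq {a t : ℝ} (ht : 0 ≤ t) (g : ℝ → ℝ) :
    rlInt 0 a g t = ∫ τ in Ioo 0 t, (t - τ) ^ (a - 1) / Real.Gamma a * g τ := by
  rw [rlInt, intervalIntegral.integral_of_le ht, integral_Ioc_eq_integral_Ioo,
    ← integral_const_mul]
  congr 1 with τ
  ring

lemma absTrunc_lconvolution_rlKernel {T a t : ℝ} (ha : 0 < a) (ht : t ∈ Icc 0 T) (g : ℝ → ℝ) :
    (absTrunc T g ⋆ₗ rlKernel a) t =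
      ∫⁻ τ in Ioo 0 t, ENNReal.ofReal |(t - τ) ^ (a - 1) / Real.Gamma a * g τ| := by
  rw [lconvolution_def, ← lintegral_indicator measurableSet_Ioo]
  refine lintegral_congr fun τ => ?_
  by_cases h : τ ∈ Ioo 0 t
  · have hΓ := Real.Gamma_pos_of_pos ha
    have h2 : 0 < t - τ := sub_pos.2 h.2
    rw [indicator_of_mem h, absTrunc, indicator_of_mem (show τ ∈ Ioc 0 T from ⟨h.1, h.2.le.trans ht.2⟩),
      rlKernel_of_pos _ (by linarith), ← ENNReal.ofReal_mul (abs_nonneg _), abs_mul,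
      abs_of_nonneg (show 0 ≤ (t - τ) ^ (a - 1) / Real.Gamma a by positivity), mul_comm,
      neg_add_eq_sub]
  · rw [indicator_of_notMem h]
    rcases le_or_gt τ 0 with h0 | h0
    · rw [absTrunc, indicator_of_notMem (fun h' => h0.not_gt h'.1), zero_mul]
    · rw [rlKernel_of_nonpos, mul_zero]
      have : t ≤ τ := not_lt.1 fun h' => h ⟨h0, h'⟩
      linarith

lemma ofReal_abs_rlInt_le {T a t : ℝ} (ha : 0 < a) (ht : t ∈ Icc 0 T) (g : ℝ → ℝ) :
    ENNReal.ofReal |rlInt 0 a g t| ≤ (absTrunc T g ⋆ₗ rlKernel a) t := by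
  rw [absTrunc_lconvolution_rlKernel ha ht, rlInt_eq ht.1]
  simpa only [Real.enorm_eq_ofReal_abs] using enorm_integral_le_lintegral_enorm
    (μ := volume.restrict (Ioo 0 t)) fun τ => (t - τ) ^ (a - 1) / Real.Gamma a * g τ

lemma integrableOn_rlInt {T a t : ℝ} (ha : 0 < a) (ht : t ∈ Icc 0 T) {g : ℝ → ℝ}
    (hg : ContinuousOn g (Icc 0 T)) :
    IntegrableOn (fun τ => (t - τ) ^ (a - 1) / Real.Gamma a * g τ) (Ioo 0 t) := by
  have h1 : IntervalIntegrable (fun τ : ℝ => (t - τ) ^ (a - 1)) volume 0 t := by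
    simpa using ((intervalIntegral.intervalIntegrable_rpow' (a := 0) (b := t)
      (show -1 < a - 1 by linarith)).comp_sub_left t).symm
  have h2 := (h1.div_const (Real.Gamma a)).mul_continuousOn (g := g)
    (by rw [uIcc_of_le ht.1]; exact hg.mono (Icc_subset_Icc_right ht.2))
  exact ((intervalIntegrable_iff_integrableOn_Ioc_of_le ht.1).1 h2).mono_set Ioo_subset_Ioc_self

lemma absTrunc_lconvolution_rlKernel_eq {T a t : ℝ} (ha : 0 < a) (ht : t ∈ Icc 0 T)
    {g : ℝ → ℝ} (hg : ContinuousOn g (Icc 0 T)) :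
    (absTrunc T g ⋆ₗ rlKernel a) t = ENNReal.ofReal (rlInt 0 a (fun τ => |g τ|) t) := by
  rw [absTrunc_lconvolution_rlKernel ha ht, rlInt_eq ht.1]
  have hΓ := Real.Gamma_pos_of_pos ha
  have hnn : ∀ τ ∈ Ioo 0 t, 0 ≤ (t - τ) ^ (a - 1) / Real.Gamma a := fun τ h => by
    have := sub_pos.2 h.2
    positivity
  rw [ofReal_integral_eq_lintegral_ofReal (integrableOn_rlInt ha ht hg.abs)]
  · refine setLIntegral_congr_fun measurableSet_Ioo fun τ h => ?_
    simp only [abs_mul, abs_of_nonneg (hnn τ h)]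
  · filter_upwards [ae_restrict_mem measurableSet_Ioo] with τ h
    exact mul_nonneg (hnn τ h) (abs_nonneg _)

lemma rlInt_sub {T a t : ℝ} (ha : 0 < a) (ht : t ∈ Icc 0 T) {g h : ℝ → ℝ}
    (hg : ContinuousOn g (Icc 0 T)) (hh : ContinuousOn h (Icc 0 T)) :
    rlInt 0 a g t - rlInt 0 a h t = rlInt 0 a (fun τ => g τ - h τ) t := by
  simp only [rlInt_eq ht.1, mul_sub]
  rw [integral_sub (integrableOn_rlInt ha ht hg) (integrableOn_rlInt ha ht hh)]

lemma absTrunc_lconvolution_rlKernel_add_le {T a b t : ℝ} (ha : 0 < a) (hb : 0 ≤ b)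
    (ht : t ≤ T) (g : ℝ → ℝ) :
    (absTrunc T g ⋆ₗ rlKernel (a + b)) t ≤
      ENNReal.ofReal (Real.Gamma a / Real.Gamma (a + b) * T ^ b) *
        (absTrunc T g ⋆ₗ rlKernel a) t := by
  rw [lconvolution_def, lconvolution_def, ← lintegral_const_mul' _ _ ENNReal.ofReal_ne_top]
  refine lintegral_mono fun τ => ?_
  rcases le_or_gt τ 0 with h0 | h0
  · rw [absTrunc, indicator_of_notMem (fun h' => h0.not_gt h'.1), zero_mul]
    exact zero_le
  rcases le_or_gt (-τ + t) 0 with h | h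
  · rw [rlKernel_of_nonpos _ h, mul_zero]
    exact zero_le
  have hΓ := Real.Gamma_pos_of_pos ha
  have hΓ' := Real.Gamma_pos_of_pos (add_pos_of_pos_of_nonneg ha hb)
  have hT : 0 < T := by linarith
  rw [mul_left_comm]
  refine mul_le_mul_right ?_ _
  rw [rlKernel_of_pos _ h, rlKernel_of_pos _ h, ← ENNReal.ofReal_mul (by positivity)]
  refine ENNReal.ofReal_le_ofReal ?_
  rw [show a + b - 1 = b + (a - 1) by ring, Real.rpow_add h]
  calc (-τ + t) ^ b * (-τ + t) ^ (a - 1) / Real.Gamma (a + b)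
      ≤ T ^ b * (-τ + t) ^ (a - 1) / Real.Gamma (a + b) := by
        gcongr
        linarith
    _ = _ := by field_simp

lemma add_lconvolution {f g k : ℝ → ℝ≥0∞} (hf : Measurable f) (hk : Measurable k) :
    (f + g) ⋆ₗ k = f ⋆ₗ k + g ⋆ₗ k := by
  ext x
  simp only [lconvolution_def, Pi.add_apply, add_mul]
  exact lintegral_add_left (hf.mul (hk.comp (by fun_prop))) _

lemma smul_lconvolution {c : ℝ≥0∞} (hc : c ≠ ∞) (f k : ℝ → ℝ≥0∞) :
    (c • f) ⋆ₗ k = c • (f ⋆ₗ k) := by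
  ext x
  simp only [lconvolution_def, Pi.smul_apply, smul_eq_mul, mul_assoc]
  exact lintegral_const_mul' _ _ hc

lemma add_smul_rlKernel_lconvolution_rlKernel {E : ℝ → ℝ≥0∞} (hE : Measurable E) {c : ℝ≥0∞}
    (hc : c ≠ ∞) {a b d : ℝ} (ha : 0 < a) (hb : 0 < b) (hd : 0 < d) :
    (E ⋆ₗ rlKernel a + c • rlKernel b) ⋆ₗ rlKernel d =
      E ⋆ₗ rlKernel (a + d) + c • rlKernel (b + d) := by
  rw [add_lconvolution (measurable_lconvolution _ hE (measurable_rlKernel a))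
      (measurable_rlKernel d), smul_lconvolution hc, rlKernel_lconvolution_rlKernel hb hd,
    ← lconvolution_assoc hE (measurable_rlKernel a) (measurable_rlKernel d),
    rlKernel_lconvolution_rlKernel ha hd]

lemma rlKernel_le {a t T : ℝ} (ha : 1 ≤ a) (ht : t ∈ Icc 0 T) :
    rlKernel a t ≤ ENNReal.ofReal (T ^ (a - 1) / Real.Gamma a) := by
  have hΓ := Real.Gamma_pos_of_pos (zero_lt_one.trans_le ha)
  rcases ht.1.eq_or_lt with h | h
  · simp [rlKernel_of_nonpos a h.symm.le]
  · rw [rlKernel_of_pos _ h]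
    refine ENNReal.ofReal_le_ofReal ?_
    gcongr
    exact ht.2

lemma bddAbove_range_abs_rlInt_sub {T a : ℝ} (ha : 0 < a) {g : ℝ → ℝ}
    (hg : ContinuousOn g (Icc 0 T)) :
    BddAbove (range fun τ : Icc (0 : ℝ) T => |rlInt 0 a g τ - g τ|) := by
  obtain ⟨M, hM⟩ := isCompact_Icc.exists_bound_of_continuousOn hg
  simp only [Real.norm_eq_abs] at hM
  refine ⟨M * (T ^ a / Real.Gamma (a + 1)) + M, ?_⟩
  rintro _ ⟨⟨t, ht⟩, rfl⟩
  have hM0 : 0 ≤ M := (abs_nonneg _).trans (hM t ht)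
  have hT : 0 ≤ T := ht.1.trans ht.2
  have hΓ := Real.Gamma_pos_of_pos (show 0 < a + 1 by linarith)
  refine (abs_sub _ _).trans (add_le_add ?_ (hM t ht))
  have hle : absTrunc T g ≤ ENNReal.ofReal M • rlKernel 1 := by
    refine indicator_le fun x hx => ?_
    rw [Pi.smul_apply, rlKernel_of_pos _ hx.1]
    simpa using ENNReal.ofReal_le_ofReal (hM x (Ioc_subset_Icc_self hx))
  have h := (ofReal_abs_rlInt_le ha ht g).trans (lconvolution_mono hle t)
  rw [smul_lconvolution ENNReal.ofReal_ne_top, rlKernel_lconvolution_rlKernel one_pos ha,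
    Pi.smul_apply, smul_eq_mul] at h
  have h2 := h.trans (mul_le_mul_right (rlKernel_le (by linarith) ht) _)
  rw [← ENNReal.ofReal_mul hM0, ENNReal.ofReal_le_ofReal_iff (by positivity)] at h2
  simpa [add_comm] using h2

/-- Fractional integral bound for a forcing term controlled by `v` and its fractional integral,
where `v` is controlled by the fractional integral of `e` up to a constant. -/
lemma abs_rlInt_le_of_perturbation {T a ε L D : ℝ} (ha : 0 < a) (hε : 0 < ε) (hε1 : ε < 1)
    (hL : 0 ≤ L) (hD : 0 ≤ D) {e u v F : ℝ → ℝ} (he : ContinuousOn e (Icc 0 T))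
    (hv : ∀ t ∈ Icc 0 T, |v t - rlInt 0 ε e t| ≤ D)
    (hu : ∀ t ∈ Icc 0 T, u t = rlInt 0 (1 - ε) v t)
    (hF : ∀ t ∈ Icc 0 T, |F t| ≤ L * (|u t| + |v t|)) {t : ℝ} (ht : t ∈ Icc 0 T) :
    |rlInt 0 a F t| ≤
      L * (Real.Gamma a / Real.Gamma (a + ε) * T ^ ε + Real.Gamma a / Real.Gamma (a + 1) * T) *
          rlInt 0 a (fun τ => |e τ|) t +
        L * (T ^ (a + 1 - ε) / Real.Gamma (a + 1 - ε + 1) + T ^ a / Real.Gamma (a + 1)) * D := by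
  have hT : 0 ≤ T := ht.1.trans ht.2
  set E := absTrunc T e with hE
  have hEm : Measurable E := measurable_absTrunc he
  have hDtop : ENNReal.ofReal D ≠ ∞ := ENNReal.ofReal_ne_top
  have hV : absTrunc T v ≤ E ⋆ₗ rlKernel ε + ENNReal.ofReal D • rlKernel 1 := by
    refine indicator_le fun x hx => ?_
    have hx' := Ioc_subset_Icc_self hx
    have h1 : |v x| ≤ |rlInt 0 ε e x| + D := by
      have := abs_add_le (rlInt 0 ε e x) (v x - rlInt 0 ε e x)
      rw [add_sub_cancel] at this
      linarith [hv x hx']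
    refine (ENNReal.ofReal_le_ofReal h1).trans ?_
    rw [ENNReal.ofReal_add (abs_nonneg _) hD, Pi.add_apply, Pi.smul_apply, rlKernel_of_pos _ hx.1]
    simpa using add_le_add_left (ofReal_abs_rlInt_le hε hx' e) (ENNReal.ofReal D)
  have hU : absTrunc T u ≤ E ⋆ₗ rlKernel 1 + ENNReal.ofReal D • rlKernel (2 - ε) := by
    refine indicator_le fun x hx => ?_
    have hx' := Ioc_subset_Icc_self hx
    rw [hu x hx']
    have h := (ofReal_abs_rlInt_le (sub_pos.2 hε1) hx' v).trans (lconvolution_mono hV x)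
    rwa [add_smul_rlKernel_lconvolution_rlKernel hEm hDtop hε one_pos (sub_pos.2 hε1),
      add_sub_cancel, show 1 + (1 - ε) = 2 - ε by ring] at h
  have hFle : absTrunc T F ≤ ENNReal.ofReal L •
      ((E ⋆ₗ rlKernel 1 + ENNReal.ofReal D • rlKernel (2 - ε)) +
        (E ⋆ₗ rlKernel ε + ENNReal.ofReal D • rlKernel 1)) := by
    refine le_trans (b := ENNReal.ofReal L • (absTrunc T u + absTrunc T v)) ?_ ?_
    · refine indicator_le fun x hx => ?_
      simp only [Pi.smul_apply, Pi.add_apply, absTrunc, indicator_of_mem hx, smul_eq_mul]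
      rw [← ENNReal.ofReal_add (abs_nonneg _) (abs_nonneg _), ← ENNReal.ofReal_mul hL]
      exact ENNReal.ofReal_le_ofReal (hF x (Ioc_subset_Icc_self hx))
    · intro x
      exact mul_le_mul_right (add_le_add (hU x) (hV x)) _
  have h := (ofReal_abs_rlInt_le ha ht F).trans (lconvolution_mono hFle t)
  have hm : Measurable (E ⋆ₗ rlKernel 1 + ENNReal.ofReal D • rlKernel (2 - ε)) :=
    (measurable_lconvolution _ hEm (measurable_rlKernel _)).add
      ((measurable_rlKernel _).const_smul _)
  rw [smul_lconvolution ENNReal.ofReal_ne_top, add_lconvolution hm (measurable_rlKernel a),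
    add_smul_rlKernel_lconvolution_rlKernel hEm hDtop one_pos (by linarith) ha,
    add_smul_rlKernel_lconvolution_rlKernel hEm hDtop hε one_pos ha] at h
  simp only [Pi.smul_apply, Pi.add_apply, smul_eq_mul] at h
  have hK : (E ⋆ₗ rlKernel a) t = ENNReal.ofReal (rlInt 0 a (fun τ => |e τ|) t) :=
    absTrunc_lconvolution_rlKernel_eq ha ht he
  have hJ : 0 ≤ rlInt 0 a (fun τ => |e τ|) t := by
    have hΓ := Real.Gamma_pos_of_pos ha
    rw [rlInt_eq ht.1]
    refine setIntegral_nonneg measurableSet_Ioo fun τ hτ => ?_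
    have := sub_pos.2 hτ.2
    positivity
  have h1 := absTrunc_lconvolution_rlKernel_add_le ha zero_le_one ht.2 e
  have h2 := absTrunc_lconvolution_rlKernel_add_le ha hε.le ht.2 e
  have h3 := rlKernel_le (a := 2 - ε + a) (by linarith) ht
  have h4 := rlKernel_le (a := 1 + a) (by linarith) ht
  have hΓ := Real.Gamma_pos_of_pos ha
  have hΓ1 := Real.Gamma_pos_of_pos (show 0 < a + 1 by linarith)
  have hΓ2 := Real.Gamma_pos_of_pos (show 0 < a + ε by linarith)
  have hΓ3 := Real.Gamma_pos_of_pos (show 0 < a + 1 - ε + 1 by linarith)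
  rw [← hE, hK, ← ENNReal.ofReal_mul (by positivity)] at h1 h2
  rw [add_comm 1 a, add_comm ε a] at h
  rw [show 2 - ε + a = a + 1 - ε + 1 by ring, add_sub_cancel_right] at h3
  rw [add_comm 1 a, add_sub_cancel_right] at h4
  rw [show 2 - ε + a = a + 1 - ε + 1 by ring] at h
  have h5 := h.trans (mul_le_mul_right (add_le_add
    (add_le_add h1 (mul_le_mul_right h3 (ENNReal.ofReal D)))
    (add_le_add h2 (mul_le_mul_right h4 (ENNReal.ofReal D)))) _)
  rw [← ENNReal.ofReal_mul hD, ← ENNReal.ofReal_mul hD,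
    ← ENNReal.ofReal_add (by positivity) (by positivity),
    ← ENNReal.ofReal_add (by positivity) (by positivity),
    ← ENNReal.ofReal_add (by positivity) (by positivity), ← ENNReal.ofReal_mul hL,
    ENNReal.ofReal_le_ofReal_iff (by positivity), Real.rpow_one] at h5
  linarith

end

theorem stmt9 (T α₂ ε s y₀ L : ℝ) (f : ℝ → ℝ → ℝ → ℝ)
    (yh w z yt zt : ℝ → ℝ)
    (hT : 0 < T) (hα₂ : 1 < α₂) (hα₂' : α₂ < 2) (hε : 0 < ε) (hε1 : ε < 1) (hL : 0 < L)
    (hfc : Continuous fun p : ℝ × ℝ × ℝ => f p.1 p.2.1 p.2.2)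
    (hlip : ∀ t ∈ Set.Icc (0:ℝ) T, ∀ x₁ x₂ y₁ y₂ : ℝ,
      |f t x₁ y₁ - f t x₂ y₂| ≤ L * (|x₁ - x₂| + |y₁ - y₂|))
    (hyh : ContinuousOn yh (Set.Icc 0 T)) (hw : ContinuousOn w (Set.Icc 0 T))
    (hz : ContinuousOn z (Set.Icc 0 T)) (hyt : ContinuousOn yt (Set.Icc 0 T))
    (hzt : ContinuousOn zt (Set.Icc 0 T))
    (heq1 : ∀ t ∈ Set.Icc (0:ℝ) T, yh t = y₀ + rlInt 0 (1 - ε) w t)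
    (heq2 : ∀ t ∈ Set.Icc (0:ℝ) T, w t = rlInt 0 ε z t)
    (heq3 : ∀ t ∈ Set.Icc (0:ℝ) T,
      z t = s + rlInt 0 (α₂ - 1) (fun τ => f τ (yh τ) (w τ)) t)
    (heq4 : ∀ t ∈ Set.Icc (0:ℝ) T, yt t = y₀ + rlInt 0 (1 - ε) zt t)
    (heq5 : ∀ t ∈ Set.Icc (0:ℝ) T,
      zt t = s + rlInt 0 (α₂ - 1) (fun τ => f τ (yt τ) (zt τ)) t) :
    ∀ t ∈ Set.Icc (0:ℝ) T,
      |z t - zt t| ≤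
        L * (Real.Gamma (α₂ - 1) / Real.Gamma (α₂ - 1 + ε) * T ^ ε
              + Real.Gamma (α₂ - 1) / Real.Gamma α₂ * T) *
            rlInt 0 (α₂ - 1) (fun τ => |z τ - zt τ|) t
          + L * (T ^ (α₂ - ε) / Real.Gamma (α₂ - ε + 1) + T ^ (α₂ - 1) / Real.Gamma α₂) *
              (⨆ τ : Set.Icc (0:ℝ) T, |rlInt 0 ε zt τ - zt τ|) := by
  intro t ht
  have ha : 0 < α₂ - 1 := by linarith
  have hcomp : ∀ g h : ℝ → ℝ, ContinuousOn g (Set.Icc 0 T) → ContinuousOn h (Set.Icc 0 T) →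
      ContinuousOn (fun τ => f τ (g τ) (h τ)) (Set.Icc 0 T) := fun g h hg hh =>
    hfc.comp_continuousOn (continuousOn_id.prodMk (hg.prodMk hh))
  have hsub : z t - zt t =
      rlInt 0 (α₂ - 1) (fun τ => f τ (yh τ) (w τ) - f τ (yt τ) (zt τ)) t := by
    rw [heq3 t ht, heq5 t ht, ← rlInt_sub ha ht (hcomp _ _ hyh hw) (hcomp _ _ hyt hzt)]
    ring
  have key := abs_rlInt_le_of_perturbation (T := T) (a := α₂ - 1) (ε := ε) (L := L)
    (D := ⨆ τ : Set.Icc (0:ℝ) T, |rlInt 0 ε zt τ - zt τ|) (e := fun τ => z τ - zt τ)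
    (u := fun τ => yh τ - yt τ) (v := fun τ => w τ - zt τ)
    (F := fun τ => f τ (yh τ) (w τ) - f τ (yt τ) (zt τ)) ha hε hε1 hL.le
    (Real.iSup_nonneg fun _ => abs_nonneg _) (hz.sub hzt)
    (fun x hx => by
      rw [← rlInt_sub hε hx hz hzt, heq2 x hx,
        show rlInt 0 ε z x - zt x - (rlInt 0 ε z x - rlInt 0 ε zt x) = rlInt 0 ε zt x - zt x by
          ring]
      exact le_ciSup (bddAbove_range_abs_rlInt_sub hε hzt) ⟨x, hx⟩)
    (fun x hx => by
      rw [heq1 x hx, heq4 x hx, ← rlInt_sub (by linarith) hx hw hzt]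
      ring)
    (fun x hx => hlip x hx _ _ _ _) ht
  rw [hsub]
  simpa only [sub_add_cancel] using key
end
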